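/- Let V be a finite-dimensional real inner product space and let R : V × V × V × V → ℝ be a quadrilinear map satisfying the curvature symmetries R(X,Y,Z,W) = −R(Y,X,Z,W), R(X,Y,Z,W) = −R(X,Y,W,Z), and R(X,Y,Z,W) = R(Z,W,X,Y). Let N := {Z ∈ V : R(X,Y,Z,W) = 0 for all X,Y,W ∈ V} be the nullity space of R, and suppose dim N⊥ ≤ 3 (equivalently, dim N ≥ dim V − 3). Then for all u, v, w, z ∈ V and all X₁, X₂, X₃, X₄ ∈ V: Σ_{ρ ∈ S₄} sgn(ρ) · R(X_{ρ(1)}, X_{ρ(2)}, u, v) · R(X_{ρ(3)}, X_{ρ(4)}, w, z) = 0. (In other words, the curvature 2-forms Ω_{uv}(X,Y) := R(X,Y,u,v) satisfy Ω_{uv} ∧ Ω_{wz} = 0.) -/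

import Mathlib

/-- The product of two bilinear forms as a 4-linear map. -/
noncomputable def prodForm {V : Type*} [AddCommGroup V] [Module ℝ V]
    (B C : V →ₗ[ℝ] V →ₗ[ℝ] ℝ) : MultilinearMap ℝ (fun _ : Fin 4 => V) ℝ :=
  MultilinearMap.mk' (fun x => B (x 0) (x 1) * C (x 2) (x 3))
    (by
      intro m i x y
      fin_cases i <;> simp [Function.update] <;> ring)
    (by
      intro m i c x
      fin_cases i <;> simp [Function.update] <;> ring)

theorem alt_sum_eq_zero {V : Type*} [AddCommGroup V] [Module ℝ V]
    (B C : V →ₗ[ℝ] V →ₗ[ℝ] ℝ) (x : Fin 4 → V) (hx : ¬ LinearIndependent ℝ x) :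
    ∑ ρ : Equiv.Perm (Fin 4), ((Equiv.Perm.sign ρ : ℤ) : ℝ) *
        (B (x (ρ 0)) (x (ρ 1)) * C (x (ρ 2)) (x (ρ 3))) = 0 := by
  have h := AlternatingMap.map_linearDependent
    (MultilinearMap.alternatization (prodForm B C)) x hx
  rw [MultilinearMap.alternatization_apply] at h
  rw [← h]
  refine Finset.sum_congr rfl fun ρ _ => ?_
  simp [prodForm, Units.smul_def]

/-- If the nullity space `N` of a quadrilinear map `R` with the curvature symmetries
satisfies `dim Nᗮ ≤ 3`, then the wedge product of any two curvature 2-forms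
`Ω_{uv}(X,Y) := R(X,Y,u,v)` vanishes. -/
theorem stmt_3 {V : Type*} [NormedAddCommGroup V] [InnerProductSpace ℝ V]
    [FiniteDimensional ℝ V]
    (R : V →ₗ[ℝ] V →ₗ[ℝ] V →ₗ[ℝ] V →ₗ[ℝ] ℝ)
    (hsym1 : ∀ X Y Z W : V, R X Y Z W = - R Y X Z W)
    (hsym2 : ∀ X Y Z W : V, R X Y Z W = - R X Y W Z)
    (hsym3 : ∀ X Y Z W : V, R X Y Z W = R Z W X Y)
    (N : Submodule ℝ V)
    (hN : ∀ Z : V, Z ∈ N ↔ ∀ X Y W : V, R X Y Z W = 0)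
    (hdim : Module.finrank ℝ Nᗮ ≤ 3) :
    ∀ (u v w z : V) (X : Fin 4 → V),
      ∑ ρ : Equiv.Perm (Fin 4), ((Equiv.Perm.sign ρ : ℤ) : ℝ) *
        (R (X (ρ 0)) (X (ρ 1)) u v * R (X (ρ 2)) (X (ρ 3)) w z) = 0 := by
  intro u v w z X
  have h1 : ∀ A ∈ N, ∀ Y a b, R A Y a b = 0 := fun A hA Y a b => by
    rw [hsym3]; exact (hN A).1 hA _ _ _
  have h2 : ∀ A ∈ N, ∀ Y a b, R Y A a b = 0 := fun A hA Y a b => by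
    rw [hsym1, h1 A hA, neg_zero]
  have hd : ∀ x : V, ∃ p : Nᗮ, x - p ∈ N := fun x =>
    ⟨Nᗮ.orthogonalProjectionOnto x, by
      have := Nᗮ.sub_starProjection_mem_orthogonal x
      rwa [Submodule.orthogonal_orthogonal] at this⟩
  choose P hP using hd
  have h3 : ∀ x y a b, R x y a b = R (P x : V) (P y : V) a b := fun x y a b => by
    have e1 := h2 _ (hP x) y a b
    have e2 := h2 _ (hP y) (P x : V) a b
    simp only [map_sub, LinearMap.sub_apply] at e1 e2
    linarith [hsym1 x y a b, hsym1 (P x : V) y a b]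
  let B : V → V → Nᗮ →ₗ[ℝ] Nᗮ →ₗ[ℝ] ℝ := fun a b =>
    LinearMap.mk₂ ℝ (fun x y => R (x : V) (y : V) a b)
      (by intros; simp) (by intros; simp) (by intros; simp) (by intros; simp)
  have hli : ¬ LinearIndependent ℝ (fun i => P (X i)) := fun h => by
    have := h.fintype_card_le_finrank
    simp at this
    omega
  have := alt_sum_eq_zero (B u v) (B w z) (fun i => P (X i)) hli
  rw [← this]
  refine Finset.sum_congr rfl fun ρ _ => ?_
  rw [h3 (X (ρ 0)), h3 (X (ρ 2))]
  rfl
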